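/- Let R be a commutative noetherian ring with unity, let N be a finitely generated R-module with annihilator b = Ann_R(N), let M be an R-module, and let c = cd(b,R) = sup{ i ≥ 0 : H^i_b(R) ≠ 0 }. If Tor^R_i(R/b, M) is a finitely generated R-module for every 0 ≤ i ≤ c, then Tor^R_i(N, M) is a finitely generated R-module for every i ≥ 0. -/

import Mathlib

open CategoryTheory

section Bridge
open Limits Opposite Abelian

variable {R : Type u} [CommRing R]

lemma HomologicalComplex.homologyπ_apply_eq_zero_iff {ι : Type*} {c : ComplexShape ι}
    (K : HomologicalComplex (ModuleCat.{u} R) c) {i j : ι} (hij : c.prev j = i)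
    (z : K.cycles j) :
    K.homologyπ j z = 0 ↔ ∃ y : K.X i, K.d i j y = K.iCycles j z := by
  have hex : (ShortComplex.mk (K.toCycles i j) (K.homologyπ j) (by simp)).Exact :=
    ShortComplex.exact_of_g_is_cokernel _ (K.homologyIsCokernel i j hij)
  rw [ShortComplex.moduleCat_exact_iff] at hex
  have hinj : Function.Injective (K.iCycles j) := (ModuleCat.mono_iff_injective _).1 inferInstance
  constructor
  · intro h
    obtain ⟨y, hy⟩ := hex z h
    refine ⟨y, ?_⟩
    rw [← hy, ← ConcreteCategory.comp_apply]
    simp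
  · rintro ⟨y, hy⟩
    have : K.toCycles i j y = z := hinj (by
      rw [← hy, ← ConcreteCategory.comp_apply]; simp)
    rw [← this, ← ConcreteCategory.comp_apply]
    simp

lemma HomologicalComplex.exists_cycles {ι : Type*} {c : ComplexShape ι}
    (K : HomologicalComplex (ModuleCat.{u} R) c) {i j : ι} (hij : c.next i = j)
    (x : K.X i) (hx : K.d i j x = 0) : ∃ z : K.cycles i, K.iCycles i z = x := by
  have hex : (ShortComplex.mk (K.iCycles i) (K.d i j) (by simp)).Exact :=
    ShortComplex.exact_of_f_is_kernel _ (K.cyclesIsKernel i j hij)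
  rw [ShortComplex.moduleCat_exact_iff] at hex
  exact hex x hx

variable {X X' Y : ModuleCat.{u} R}

/-- The map of Hom complexes induced by a chain map. -/
def ChainComplex.linearYonedaMap {K L : ChainComplex (ModuleCat.{u} R) ℕ} (φ : K ⟶ L)
    (Y : ModuleCat.{u} R) : L.linearYonedaObj R Y ⟶ K.linearYonedaObj R Y :=
  (HomologicalComplex.unopFunctor _ _).map
    (((((linearYoneda R _).obj Y).rightOp.mapHomologicalComplex _).map φ).op)

lemma CategoryTheory.Iso.unop_comp_inv_unop_of_comp_hom_eq {C : Type*} [Category C]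
    {A B : Cᵒᵖ} {A' B' : C} (e : A ≅ op A') (e' : B ≅ op B') {a : A ⟶ B} {f : B' ⟶ A'}
    (h : a ≫ e'.hom = e.hom ≫ f.op) : a.unop ≫ e.inv.unop = e'.inv.unop ≫ f := by
  have h' : e.inv ≫ a = f.op ≫ e'.inv := by
    rw [Iso.inv_comp_eq, ← Category.assoc, ← h, Category.assoc, Iso.hom_inv_id, Category.comp_id]
  exact congrArg Quiver.Hom.unop h'

lemma CategoryTheory.ProjectiveResolution.isoExt_hom_naturality
    (P : ProjectiveResolution X) (P' : ProjectiveResolution X') (g : X' ⟶ X)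
    (φ : ProjectiveResolution.Hom P' P g) (n : ℕ) :
    ((Ext R (ModuleCat.{u} R) n).map g.op).app Y ≫ (P'.isoExt (R := R) n Y).hom =
      (P.isoExt (R := R) n Y).hom ≫
        HomologicalComplex.homologyMap (ChainComplex.linearYonedaMap φ.hom Y) n := by
  have h1 := ProjectiveResolution.isoLeftDerivedObj_inv_naturality g P' P φ.hom
    φ.hom_f_zero_comp_π_f_zero ((linearYoneda R _).obj Y).rightOp n
  have h2 := HomologicalComplex.homologyOp_hom_naturality
    (ChainComplex.linearYonedaMap φ.hom Y) n
  have h3 := CategoryTheory.Iso.unop_comp_inv_unop_of_comp_hom_eq _ _ h2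
  exact (CommSq.vert_comp ⟨congrArg Quiver.Hom.unop h1⟩ ⟨h3⟩).w

lemma CategoryTheory.ProjectiveResolution.extMap_eq_zero_iff
    (P : ProjectiveResolution X) (P' : ProjectiveResolution X') (g : X' ⟶ X)
    (φ : ProjectiveResolution.Hom P' P g) (n : ℕ) (f : P.complex.X (n + 1) ⟶ Y)
    (z : (P.complex.linearYonedaObj R Y).cycles (n + 1))
    (hz : (P.complex.linearYonedaObj R Y).iCycles (n + 1) z = f)
    (ξ : ((Ext R (ModuleCat.{u} R) (n + 1)).obj (op X)).obj Y)
    (hξ : (P.isoExt (R := R) (n + 1) Y).hom ξ =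
      (P.complex.linearYonedaObj R Y).homologyπ (n + 1) z) :
    ((Ext R (ModuleCat.{u} R) (n + 1)).map g.op).app Y ξ = 0 ↔
      ∃ h : P'.complex.X n ⟶ Y, P'.complex.d (n + 1) n ≫ h = φ.hom.f (n + 1) ≫ f := by
  have hinj : Function.Injective (P'.isoExt (R := R) (n + 1) Y).hom :=
    (ModuleCat.mono_iff_injective _).1 inferInstance
  rw [← map_eq_zero_iff _ hinj, ← ConcreteCategory.comp_apply,
    ProjectiveResolution.isoExt_hom_naturality P P' g φ, ConcreteCategory.comp_apply, hξ,
    ← ConcreteCategory.comp_apply, HomologicalComplex.homologyπ_naturality,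
    ConcreteCategory.comp_apply,
    HomologicalComplex.homologyπ_apply_eq_zero_iff _ (i := n) (by simp),
    ← ConcreteCategory.comp_apply, HomologicalComplex.cyclesMap_i, ConcreteCategory.comp_apply, hz]
  rfl

lemma CategoryTheory.ProjectiveResolution.mk₀_comp_extMk_eq_zero_iff
    (P : ProjectiveResolution X) (P' : ProjectiveResolution X') (g : X' ⟶ X)
    (φ : ProjectiveResolution.Hom P' P g) (n : ℕ) (f : P.complex.X (n + 1) ⟶ Y)
    (hf : P.complex.d (n + 2) (n + 1) ≫ f = 0) :
    (Ext.mk₀ g).comp (P.extMk f (n + 2) rfl hf) (zero_add _) = 0 ↔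
      ∃ h : P'.complex.X n ⟶ Y, P'.complex.d (n + 1) n ≫ h = φ.hom.f (n + 1) ≫ f := by
  rw [ProjectiveResolution.mk₀_comp_extMk _ _ _ _ φ,
    ProjectiveResolution.extMk_eq_zero_iff _ _ _ _ _ n rfl]

/-- A lift of a morphism to projective resolutions. -/
noncomputable def CategoryTheory.ProjectiveResolution.liftHom (P : ProjectiveResolution X)
    (P' : ProjectiveResolution X') (g : X' ⟶ X) : ProjectiveResolution.Hom P' P g where
  hom := ProjectiveResolution.lift g P' P
  hom_f_zero_comp_π_f_zero := by
    rw [← HomologicalComplex.comp_f, ProjectiveResolution.lift_commutes,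
      HomologicalComplex.comp_f]

lemma exists_ext_class_of_extFunctor (n : ℕ)
    (ξ : ((Ext R (ModuleCat.{u} R) (n + 1)).obj (op X)).obj Y) :
    ∃ η : Abelian.Ext X Y (n + 1), ∀ (X' : ModuleCat.{u} R) (g : X' ⟶ X),
      ((Ext R (ModuleCat.{u} R) (n + 1)).map g.op).app Y ξ = 0 ↔
        (Ext.mk₀ g).comp η (zero_add _) = 0 := by
  let P := projectiveResolution X
  have hsurj : Function.Surjective ((P.complex.linearYonedaObj R Y).homologyπ (n + 1)) :=
    (ModuleCat.epi_iff_surjective _).1 inferInstance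
  obtain ⟨z, hz⟩ := hsurj ((P.isoExt (R := R) (n + 1) Y).hom ξ)
  have hd : (P.complex.linearYonedaObj R Y).d (n + 1) (n + 2)
      ((P.complex.linearYonedaObj R Y).iCycles (n + 1) z) = 0 := by
    rw [← ConcreteCategory.comp_apply, HomologicalComplex.iCycles_d]
    rfl
  refine ⟨P.extMk ((P.complex.linearYonedaObj R Y).iCycles (n + 1) z) (n + 2) rfl hd,
    fun X' g => ?_⟩
  exact (ProjectiveResolution.extMap_eq_zero_iff P (projectiveResolution X') g
    (P.liftHom _ g) n _ z rfl ξ hz.symm).trans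
    (ProjectiveResolution.mk₀_comp_extMk_eq_zero_iff P _ g (P.liftHom _ g) n _ hd).symm

lemma exists_extFunctor_class_of_ext (n : ℕ) (η : Abelian.Ext X Y (n + 1)) :
    ∃ ξ : ((Ext R (ModuleCat.{u} R) (n + 1)).obj (op X)).obj Y,
      ∀ (X' : ModuleCat.{u} R) (g : X' ⟶ X),
      ((Ext R (ModuleCat.{u} R) (n + 1)).map g.op).app Y ξ = 0 ↔
        (Ext.mk₀ g).comp η (zero_add _) = 0 := by
  let P := projectiveResolution X
  obtain ⟨f, hf, rfl⟩ := P.extMk_surjective η (n + 2) rfl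
  obtain ⟨z, hz⟩ := HomologicalComplex.exists_cycles (P.complex.linearYonedaObj R Y)
    (i := n + 1) (j := n + 2) (by simp) f hf
  refine ⟨(P.isoExt (R := R) (n + 1) Y).inv
    ((P.complex.linearYonedaObj R Y).homologyπ (n + 1) z), fun X' g => ?_⟩
  rw [ProjectiveResolution.extMap_eq_zero_iff P (projectiveResolution X') g
    (P.liftHom _ g) n f z hz _ (by simp),
    ProjectiveResolution.mk₀_comp_extMk_eq_zero_iff]

/-- The projection `R ⧸ b ^ t ⟶ R ⧸ b ^ s` for `s ≤ t`. -/
def quotientPowMap (b : Ideal R) {s t : ℕ} (h : s ≤ t) :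
    ModuleCat.of R (R ⧸ b ^ t) ⟶ ModuleCat.of R (R ⧸ b ^ s) :=
  ModuleCat.ofHom (Submodule.mapQ _ _ LinearMap.id (Ideal.pow_le_pow_right h))

/-- Every class of degree `j` in `Ext (R ⧸ b ^ s) X` restricts to zero on `R ⧸ b ^ t` for some
`t ≥ s`. -/
def ExtDies (b : Ideal R) (X : ModuleCat.{u} R) (j : ℕ) : Prop :=
  ∀ (s : ℕ) (ξ : Abelian.Ext (ModuleCat.of R (R ⧸ b ^ s)) X j),
    ∃ (t : ℕ) (h : s ≤ t), (Ext.mk₀ (quotientPowMap b h)).comp ξ (zero_add j) = 0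

lemma subsingleton_localCohomology_iff_extFunctor (b : Ideal R) (j : ℕ) (X : ModuleCat.{u} R) :
    Subsingleton ((localCohomology b j).obj X) ↔
      ∀ (s : ℕ) (ξ : ((Ext R (ModuleCat.{u} R) j).obj
        (op (ModuleCat.of R (R ⧸ b ^ s)))).obj X),
      ∃ (t : ℕ) (h : s ≤ t),
        ((Ext R (ModuleCat.{u} R) j).map (quotientPowMap b h).op).app X ξ = 0 := by
  let D := localCohomology.diagram (localCohomology.idealPowersDiagram b) j
  let hc : IsColimit (((evaluation _ _).obj X).mapCocone (colimit.cocone D)) :=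
    isColimitOfPreserves ((evaluation (ModuleCat.{u} R) (ModuleCat.{u} R)).obj X)
      (colimit.isColimit D)
  have : IsFiltered (ℕᵒᵖᵒᵖ) := isFiltered_op_of_isCofiltered _
  have : PreservesFilteredColimitsOfSize.{0, 0} (forget (ModuleCat.{u} R)) :=
    preservesFilteredColimitsOfSize_shrink.{0, u, 0, u} _
  have : PreservesColimit (D ⋙ (evaluation _ _).obj X) (forget (ModuleCat.{u} R)) :=
    inferInstance
  constructor
  · intro hs s ξ
    obtain ⟨k, f, g, hfg⟩ := Concrete.isColimit_exists_of_rep_eq _ hc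
      (i := op (op s)) (j := op (op s)) ξ 0 (hs.elim _ _)
    refine ⟨k.unop.unop, f.unop.unop.down.down, ?_⟩
    rw [map_zero] at hfg
    exact hfg
  · intro h
    refine subsingleton_of_forall_eq 0 fun x => ?_
    obtain ⟨k, y, rfl⟩ := Concrete.isColimit_exists_rep _ hc x
    obtain ⟨t, ht, hty⟩ := h k.unop.unop y
    have := Concrete.isColimit_rep_eq_of_exists _
      (D := ((evaluation _ _).obj X).mapCocone (colimit.cocone D)) (i := k) (j := k) y 0
      ⟨op (op t), (homOfLE ht).op.op, (homOfLE ht).op.op, by rw [map_zero]; exact hty⟩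
    rw [map_zero] at this
    exact this

lemma subsingleton_localCohomology_iff (b : Ideal R) (j : ℕ) (X : ModuleCat.{u} R) :
    Subsingleton ((localCohomology b (j + 1)).obj X) ↔ ExtDies b X (j + 1) := by
  rw [subsingleton_localCohomology_iff_extFunctor]
  constructor
  · intro h s η
    obtain ⟨ξ, hξ⟩ := exists_extFunctor_class_of_ext j η
    obtain ⟨t, ht, h0⟩ := h s ξ
    exact ⟨t, ht, (hξ _ _).1 h0⟩
  · intro h s ξ
    obtain ⟨η, hη⟩ := exists_ext_class_of_extFunctor j ξ
    obtain ⟨t, ht, h0⟩ := h s η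
    exact ⟨t, ht, (hη _ _).2 h0⟩

end Bridge

section ExtDies
open Limits Opposite Abelian

variable {R : Type u} [CommRing R]

lemma quotientPowMap_comp (b : Ideal R) {s t r : ℕ} (h : s ≤ t) (h' : t ≤ r) :
    quotientPowMap b h' ≫ quotientPowMap b h = quotientPowMap b (h.trans h') := by
  ext; rfl

lemma Function.Exact.moduleCat_shortExact {A B C : Type u} [AddCommGroup A] [AddCommGroup B]
    [AddCommGroup C] [Module R A] [Module R B] [Module R C] {f : A →ₗ[R] B} {g : B →ₗ[R] C}
    (hf : Function.Injective f) (hfg : Function.Exact f g) (hg : Function.Surjective g) :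
    (ModuleCat.shortComplexOfCompEqZero f g hfg.linearMap_comp_eq_zero).ShortExact :=
  ModuleCat.shortComplex_shortExact _ hfg hf hg

variable {b : Ideal R} {S : ShortComplex (ModuleCat.{u} R)}

lemma quotientPowMap_comp_eq_zero {X : ModuleCat.{u} R} {s t r j : ℕ} (h : s ≤ t) (h' : t ≤ r)
    {ξ : Abelian.Ext (ModuleCat.of R (R ⧸ b ^ s)) X j}
    (h0 : (Ext.mk₀ (quotientPowMap b h')).comp
      ((Ext.mk₀ (quotientPowMap b h)).comp ξ (zero_add j)) (zero_add j) = 0) :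
    (Ext.mk₀ (quotientPowMap b (h.trans h'))).comp ξ (zero_add j) = 0 := by
  rwa [Ext.mk₀_comp_mk₀_assoc, quotientPowMap_comp] at h0

lemma ExtDies.middle (hS : S.ShortExact) {j : ℕ} (h₁ : ExtDies b S.X₁ j)
    (h₃ : ExtDies b S.X₃ j) : ExtDies b S.X₂ j := by
  intro s ξ
  obtain ⟨t, hst, ht⟩ := h₃ s (ξ.comp (Ext.mk₀ S.g) (add_zero _))
  rw [← Ext.comp_assoc_of_third_deg_zero] at ht
  obtain ⟨η, hη⟩ := Ext.covariant_sequence_exact₂ _ hS _ ht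
  obtain ⟨r, htr, hr⟩ := h₁ t η
  refine ⟨r, hst.trans htr, quotientPowMap_comp_eq_zero hst htr ?_⟩
  rw [← hη, ← Ext.comp_assoc_of_third_deg_zero, hr, Ext.zero_comp]

lemma ExtDies.right (hS : S.ShortExact) {j : ℕ} (h₂ : ExtDies b S.X₂ j)
    (h₁ : ExtDies b S.X₁ (j + 1)) : ExtDies b S.X₃ j := by
  intro s ξ
  obtain ⟨t, hst, ht⟩ := h₁ s (ξ.comp hS.extClass rfl)
  rw [← Ext.comp_assoc (a₁₂ := j) _ _ _ (by lia) (by lia) (by lia)] at ht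
  obtain ⟨η, hη⟩ := Ext.covariant_sequence_exact₃ _ hS _ _ ht
  obtain ⟨r, htr, hr⟩ := h₂ t η
  refine ⟨r, hst.trans htr, quotientPowMap_comp_eq_zero hst htr ?_⟩
  rw [← hη, ← Ext.comp_assoc_of_third_deg_zero, hr, Ext.zero_comp]

lemma ExtDies.left (hS : S.ShortExact) {j : ℕ} (h₃ : ExtDies b S.X₃ j)
    (h₂ : ExtDies b S.X₂ (j + 1)) : ExtDies b S.X₁ (j + 1) := by
  intro s ξ
  obtain ⟨t, hst, ht⟩ := h₂ s (ξ.comp (Ext.mk₀ S.f) (add_zero _))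
  rw [← Ext.comp_assoc_of_third_deg_zero] at ht
  obtain ⟨η, hη⟩ := Ext.covariant_sequence_exact₁ _ hS _ ht rfl
  obtain ⟨r, htr, hr⟩ := h₃ t η
  refine ⟨r, hst.trans htr, quotientPowMap_comp_eq_zero hst htr ?_⟩
  rw [← hη, ← Ext.comp_assoc (a₁₂ := j) _ _ _ (by lia) (by lia) (by lia), hr, Ext.zero_comp]

lemma ExtDies.of_injective (X : ModuleCat.{u} R) [Injective X] (j : ℕ) : ExtDies b X (j + 1) :=
  fun s ξ => ⟨s, le_rfl, by rw [Ext.eq_zero_of_injective ξ, Ext.comp_zero]⟩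

lemma ExtDies.of_isUnit {X : ModuleCat.{u} R} {x : R} (hx : x ∈ b)
    (hu : IsUnit (algebraMap R (Module.End R X) x)) (j : ℕ) : ExtDies b X j := by
  intro s ξ
  refine ⟨s, le_rfl, ?_⟩
  obtain ⟨v, hv⟩ := (hu.pow s).exists_left_inv
  rw [← map_pow] at hv
  suffices ξ = 0 by rw [this, Ext.comp_zero]
  have h1 : x ^ s • ξ = 0 := by
    rw [← Ext.mk₀_id_comp ξ, ← Ext.smul_comp, ← Ext.mk₀_smul]
    have : x ^ s • 𝟙 (ModuleCat.of R (R ⧸ b ^ s)) = 0 := by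
      ext
      simp only [ModuleCat.hom_smul, ModuleCat.hom_id]
      change (Ideal.Quotient.mk (b ^ s) (x ^ s * 1)) = 0
      rw [mul_one, Ideal.Quotient.eq_zero_iff_mem]
      exact Ideal.pow_mem_pow hx s
    rw [this, Ext.mk₀_zero, Ext.zero_comp]
  have h2 : x ^ s • 𝟙 X ≫ ModuleCat.ofHom v = 𝟙 X := by
    ext a
    have h : v (x ^ s • a) = a := LinearMap.congr_fun hv a
    rw [map_smul] at h
    simpa using h
  rw [← Ext.comp_mk₀_id ξ, ← h2, Ext.mk₀_smul, Ext.comp_smul, ← Ext.smul_comp, h1, Ext.zero_comp]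

lemma ExtDies.of_subsingleton {X : ModuleCat.{u} R} (hX : Subsingleton X) (j : ℕ) :
    ExtDies b X j :=
  ExtDies.of_isUnit b.zero_mem (isUnit_of_subsingleton _) j

end ExtDies

section PowTorsion
open Limits Opposite Abelian

variable {R : Type u} [CommRing R]

/-- The submodule of elements killed by some power of the ideal `b`. -/
def Ideal.powTorsion (b : Ideal R) (E : Type*) [AddCommGroup E] [Module R E] :
    Submodule R E where
  carrier := {e | ∃ m : ℕ, ∀ r ∈ b ^ m, r • e = 0}
  add_mem' := by
    rintro x y ⟨m, hm⟩ ⟨n, hn⟩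
    refine ⟨max m n, fun r hr => ?_⟩
    rw [smul_add, hm r (Ideal.pow_le_pow_right (le_max_left _ _) hr),
      hn r (Ideal.pow_le_pow_right (le_max_right _ _) hr), add_zero]
  zero_mem' := ⟨0, fun r _ => smul_zero r⟩
  smul_mem' := by
    rintro c x ⟨m, hm⟩
    exact ⟨m, fun r hr => by rw [smul_comm, hm r hr, smul_zero]⟩

lemma Module.Injective.exists_comp_eq_of_ker_le {A B E : Type u} [AddCommGroup A] [AddCommGroup B]
    [AddCommGroup E] [Module R A] [Module R B] [Module R E] [Module.Injective R E]
    (φ : A →ₗ[R] B) (g : A →ₗ[R] E) (h : φ.ker ≤ g.ker) : ∃ k : B →ₗ[R] E, k ∘ₗ φ = g := by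
  obtain ⟨k, hk⟩ := Module.Injective.out (Q := E) (φ.ker.liftQ φ le_rfl)
    (LinearMap.ker_eq_bot.1 (Submodule.ker_liftQ_eq_bot _ _ _ le_rfl)) (φ.ker.liftQ g h)
  exact ⟨k, LinearMap.ext fun x => hk (φ.ker.mkQ x)⟩

lemma Ideal.exists_pow_le_ker_of_fg {b : Ideal R} {A E : Type*} [AddCommGroup A] [AddCommGroup E]
    [Module R A] [Module R E] [Module.Finite R A] (g : A →ₗ[R] E)
    (hg : ∀ a, g a ∈ b.powTorsion E) : ∃ m : ℕ, ∀ r ∈ b ^ m, ∀ a, r • g a = 0 := by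
  obtain ⟨s, hs⟩ := Module.Finite.fg_top (R := R) (M := A)
  choose m hm using hg
  refine ⟨s.sup m, fun r hr a => ?_⟩
  have : Submodule.span R (s : Set A) ≤ (r • g).ker := by
    rw [Submodule.span_le]
    intro x hx
    exact hm x r (Ideal.pow_le_pow_right (Finset.le_sup (f := m) hx) hr)
  exact this (hs ▸ Submodule.mem_top : a ∈ _)

instance Ideal.powTorsion_injective [IsNoetherianRing R] (b : Ideal R) (E : Type u)
    [AddCommGroup E] [Module R E] [Module.Injective R E] :
    Module.Injective R (b.powTorsion E) := by
  refine Module.Baer.injective fun I g => ?_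
  obtain ⟨m, hm⟩ := Ideal.exists_pow_le_ker_of_fg (b := b) ((b.powTorsion E).subtype ∘ₗ g)
    fun a => (g a).2
  obtain ⟨k, hk⟩ := Ideal.exists_pow_inf_eq_pow_smul b (I : Submodule R R)
  have hle : ∀ x : I, (x : R) ∈ b ^ (m + k) → g x = 0 := by
    intro x hx
    have h1 : (x : R) ∈ b ^ (m + k) • (⊤ : Submodule R R) ⊓ I := ⟨by simpa using hx, x.2⟩
    rw [hk _ (Nat.le_add_left k m), Nat.add_sub_cancel] at h1
    have h2 : (x : R) ∈ b ^ m • (I : Submodule R R) :=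
      Submodule.smul_mono le_rfl inf_le_right h1
    have h3 : ∀ y ∈ b ^ m • (I : Submodule R R), ∃ hy : y ∈ I, g ⟨y, hy⟩ = 0 := by
      intro y hy
      refine Submodule.smul_induction_on hy (fun r hr n hn => ?_) ?_
      · refine ⟨I.smul_mem r hn, ?_⟩
        have := hm r hr ⟨n, hn⟩
        apply Subtype.ext
        rw [← SetLike.mk_smul_mk, map_smul]
        exact this
      · rintro y z ⟨hy, hy0⟩ ⟨hz, hz0⟩
        refine ⟨add_mem hy hz, ?_⟩
        rw [← AddMemClass.mk_add_mk _ _ _ hy hz, map_add, hy0, hz0, add_zero]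
    exact (h3 _ h2).2
  obtain ⟨h, hh⟩ := Module.Injective.exists_comp_eq_of_ker_le
    ((b ^ (m + k)).mkQ ∘ₗ I.subtype) ((b.powTorsion E).subtype ∘ₗ g) (by
      intro x hx
      have : g x = 0 := hle x ((Submodule.Quotient.mk_eq_zero _).1 hx)
      simp [this])
  have hmem : ∀ x, h x ∈ b.powTorsion E := by
    intro x
    obtain ⟨y, rfl⟩ := Submodule.mkQ_surjective _ x
    refine ⟨m + k, fun r hr => ?_⟩
    have h0 : (b ^ (m + k)).mkQ (r • y) = 0 :=
      (Submodule.Quotient.mk_eq_zero _).2 (Ideal.mul_mem_right y _ hr)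
    rw [← map_smul, ← map_smul, h0, map_zero]
  refine ⟨h.codRestrict _ hmem ∘ₗ (b ^ (m + k)).mkQ, fun x hx => ?_⟩
  exact Subtype.ext (LinearMap.congr_fun hh ⟨x, hx⟩)

lemma ExtDies.one_of_shortExact {b : Ideal R} {S : ShortComplex (ModuleCat.{u} R)}
    (hS : S.ShortExact) [Injective S.X₂] (h₂ : b.powTorsion S.X₂ = ⊤) : ExtDies b S.X₁ 1 := by
  intro s ξ
  obtain ⟨η, rfl⟩ := Ext.covariant_sequence_exact₁ _ hS ξ (Ext.eq_zero_of_injective _)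
    (zero_add 1)
  obtain ⟨q, rfl⟩ := (Ext.mk₀_bijective _ _).surjective η
  have : Function.Surjective S.g := (ModuleCat.epi_iff_surjective _).1 hS.epi_g
  obtain ⟨g, hg⟩ := this (q (Ideal.Quotient.mk _ 1))
  obtain ⟨m, hm⟩ := (h₂ ▸ Submodule.mem_top : g ∈ b.powTorsion S.X₂)
  let t := max s m
  let l : ModuleCat.of R (R ⧸ b ^ t) ⟶ S.X₂ := ModuleCat.ofHom
    (Submodule.liftQ _ (LinearMap.toSpanSingleton R S.X₂ g) fun r hr =>
      hm r (Ideal.pow_le_pow_right (le_max_right _ _) hr))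
  refine ⟨t, le_max_left _ _, ?_⟩
  have hl : quotientPowMap b (le_max_left s m) ≫ q = l ≫ S.g := by
    ext
    change q (Ideal.Quotient.mk _ 1) = S.g ((1 : R) • g)
    rw [one_smul, hg]
  rw [Ext.mk₀_comp_mk₀_assoc, hl, ← Ext.mk₀_comp_mk₀_assoc, hS.comp_extClass, Ext.comp_zero]

lemma ExtDies.of_powTorsion_eq_top [IsNoetherianRing R] {b : Ideal R} (j : ℕ) :
    ∀ (X : ModuleCat.{u} R), b.powTorsion X = ⊤ → ExtDies b X (j + 1) := by
  have key : ∀ X : ModuleCat.{u} R, b.powTorsion X = ⊤ →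
      ∃ S : ShortComplex (ModuleCat.{u} R), S.ShortExact ∧ S.X₁ = X ∧ Injective S.X₂ ∧
        b.powTorsion S.X₂ = ⊤ ∧ b.powTorsion S.X₃ = ⊤ := by
    intro X hX
    let E : ModuleCat.{u} R := Injective.under X
    have : Injective (ModuleCat.of R E) := inferInstanceAs (Injective (Injective.under X))
    have : Module.Injective R E := Module.injective_module_of_injective_object R E
    let f : X →ₗ[R] b.powTorsion E := (Injective.ι X).hom.codRestrict _ fun x => by
      obtain ⟨m, hm⟩ := (hX ▸ Submodule.mem_top : x ∈ b.powTorsion X)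
      exact ⟨m, fun r hr => by rw [← map_smul, hm r hr, map_zero]⟩
    have hf : Function.Injective f := fun x y hxy =>
      (ModuleCat.mono_iff_injective (Injective.ι X)).1 inferInstance (congrArg Subtype.val hxy)
    have h2 : b.powTorsion (b.powTorsion E) = ⊤ := by
      refine eq_top_iff.2 fun x _ => ?_
      obtain ⟨m, hm⟩ := x.2
      exact ⟨m, fun r hr => Subtype.ext (hm r hr)⟩
    refine ⟨_, (LinearMap.exact_map_mkQ_range f).moduleCat_shortExact hf
      (Submodule.mkQ_surjective _), rfl, Module.injective_object_of_injective_module R _, h2,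
      eq_top_iff.2 fun x _ => ?_⟩
    obtain ⟨y, rfl⟩ := Submodule.mkQ_surjective _ x
    obtain ⟨m, hm⟩ := (h2 ▸ Submodule.mem_top : y ∈ b.powTorsion (b.powTorsion E))
    exact ⟨m, fun r hr => by rw [← map_smul, hm r hr, map_zero]⟩
  induction j with
  | zero =>
    intro X hX
    obtain ⟨S, hS, rfl, _, h2, -⟩ := key X hX
    exact ExtDies.one_of_shortExact hS h2
  | succ j ih =>
    intro X hX
    obtain ⟨S, hS, rfl, _, -, h3⟩ := key X hX
    exact ExtDies.left hS (ih _ h3) (ExtDies.of_injective _ _)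

end PowTorsion

section Bound
open Limits Opposite Abelian

variable {R : Type u} [CommRing R] [IsNoetherianRing R]

lemma ExtDies.of_card_lt {b : Ideal R} [DecidableEq R] (U : Finset R) :
    ∀ (T : Finset R) (_ : Ideal.span ((T ∪ U : Finset R) : Set R) = b) (X : ModuleCat.{u} R)
      (_ : ∀ x ∈ T, ∀ v : X, ∃ m : ℕ, x ^ m • v = 0) (j : ℕ) (_ : U.card < j), ExtDies b X j := by
  induction U using Finset.induction_on with
  | empty =>
    intro T hT X hX j hj
    obtain ⟨i, rfl⟩ := Nat.exists_eq_add_of_lt hj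
    refine ExtDies.of_powTorsion_eq_top _ X (eq_top_iff.2 fun v _ => ?_)
    have : b ≤ Ideal.radical (LinearMap.toSpanSingleton R X v).ker := by
      rw [← hT, Ideal.span_le]
      intro x hx
      obtain ⟨m, hm⟩ := hX x (by simpa using hx) v
      exact ⟨m, hm⟩
    obtain ⟨n, hn⟩ := Ideal.exists_pow_le_of_le_radical_of_fg this (IsNoetherian.noetherian _)
    exact ⟨n, fun r hr => hn hr⟩
  | insert a U ha ih =>
    intro T hT X hX j hj
    rw [Finset.card_insert_of_notMem ha] at hj
    obtain ⟨i, rfl⟩ : ∃ i, j = i + 1 := ⟨j - 1, by omega⟩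
    have hT' : Ideal.span ((insert a T ∪ U : Finset R) : Set R) = b := by
      rw [← hT, Finset.insert_union, Finset.union_insert]
    have hab : a ∈ b := hT ▸ Ideal.subset_span (by simp)
    let f := LocalizedModule.mkLinearMap (Submonoid.powers a) X
    have hunit : ∀ n : ℕ, Function.Injective fun y : LocalizedModule (Submonoid.powers a) X =>
        a ^ n • y := fun n =>
      ((Module.End.isUnit_iff _).1 (IsLocalizedModule.map_units f
        (⟨a ^ n, n, rfl⟩ : Submonoid.powers a))).injective
    have hloc : ∀ x ∈ T, ∀ y : LocalizedModule (Submonoid.powers a) X,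
        ∃ m : ℕ, x ^ m • y = 0 := by
      intro x hx y
      obtain ⟨⟨v, ⟨_, n, rfl⟩⟩, hv⟩ := IsLocalizedModule.surj (Submonoid.powers a) f y
      obtain ⟨m, hm⟩ := hX x hx v
      refine ⟨m, hunit n ?_⟩
      change a ^ n • y = f v at hv
      change a ^ n • x ^ m • y = a ^ n • 0
      rw [smul_comm, hv, ← map_smul, hm, map_zero, smul_zero]
    have hL : ExtDies b (ModuleCat.of R (LocalizedModule (Submonoid.powers a) X)) (i + 1) :=
      ExtDies.of_isUnit hab (IsLocalizedModule.map_units f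
        (⟨a, 1, pow_one a⟩ : Submonoid.powers a)) _
    have hQ : ExtDies b (ModuleCat.of R (LocalizedModule (Submonoid.powers a) X ⧸ f.range)) i := by
      refine ih (insert a T) hT' _ (fun x hx y => ?_) i (by omega)
      obtain ⟨y, rfl⟩ := Submodule.mkQ_surjective _ y
      obtain rfl | hx := Finset.mem_insert.1 hx
      · obtain ⟨⟨v, ⟨_, n, rfl⟩⟩, hv⟩ := IsLocalizedModule.surj (Submonoid.powers x) f y
        refine ⟨n, (map_smul f.range.mkQ (x ^ n) y).symm.trans ?_⟩
        exact (Submodule.Quotient.mk_eq_zero _).2 ⟨v, hv.symm⟩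
      · obtain ⟨m, hm⟩ := hloc x hx y
        exact ⟨m, (map_smul f.range.mkQ (x ^ m) y).symm.trans (by rw [hm, map_zero])⟩
    have hK : ExtDies b (ModuleCat.of R f.ker) (i + 1) := by
      refine ih (insert a T) hT' _ (fun x hx y => ?_) _ (by omega)
      obtain rfl | hx := Finset.mem_insert.1 hx
      · obtain ⟨⟨_, n, rfl⟩, hn⟩ := (IsLocalizedModule.eq_zero_iff (Submonoid.powers x) f).1 y.2
        exact ⟨n, Subtype.ext hn⟩
      · obtain ⟨m, hm⟩ := hX x hx y
        exact ⟨m, Subtype.ext hm⟩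
    have hI : ExtDies b (ModuleCat.of R f.range) (i + 1) :=
      ExtDies.left ((LinearMap.exact_subtype_mkQ f.range).moduleCat_shortExact
        (Submodule.subtype_injective _) (Submodule.mkQ_surjective _)) hQ hL
    refine ExtDies.middle (S := f.rangeRestrict.shortComplexKer)
      (LinearMap.shortExact_shortComplexKer f.surjective_rangeRestrict) ?_ hI
    change ExtDies b (ModuleCat.of R f.rangeRestrict.ker) (i + 1)
    rwa [LinearMap.ker_rangeRestrict]

lemma exists_forall_extDies (b : Ideal R) :
    ∃ d : ℕ, ∀ (X : ModuleCat.{u} R) (j : ℕ), d < j → ExtDies b X j := by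
  classical
  obtain ⟨U, hU⟩ := IsNoetherian.noetherian b
  exact ⟨U.card, fun X j hj => ExtDies.of_card_lt U ∅ (by simpa using hU) X
    (fun x hx => absurd hx (Finset.notMem_empty x)) j hj⟩

lemma ModuleCat.pi_fin_of_extension {R : Type u} [Ring R] {p : ModuleCat.{u} R → Prop}
    (h₀ : ∀ X : ModuleCat.{u} R, Subsingleton X → p X)
    (h : ∀ S : ShortComplex (ModuleCat.{u} R), S.ShortExact → p S.X₁ → p S.X₃ → p S.X₂)
    {A : Type u} [AddCommGroup A] [Module R A] (hA : p (ModuleCat.of R A)) (n : ℕ) :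
    p (ModuleCat.of R (Fin n → A)) := by
  induction n with
  | zero => exact h₀ _ inferInstance
  | succ n ih =>
    have hex : Function.Exact (LinearMap.single R (fun _ : Fin (n + 1) => A) 0)
        (LinearMap.funLeft R A (Fin.succ : Fin n → Fin (n + 1))) := by
      intro x
      constructor
      · intro hx
        refine ⟨x 0, funext fun i => ?_⟩
        cases i using Fin.cases with
        | zero => simp
        | succ i => simpa using (congrFun hx i).symm
      · rintro ⟨a, rfl⟩
        ext i
        simp [LinearMap.funLeft]
    exact h _ (ModuleCat.shortComplex_shortExact
      (ModuleCat.shortComplexOfCompEqZero _ _ hex.linearMap_comp_eq_zero) hex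
      (Pi.single_injective (M := fun _ : Fin (n + 1) => A) 0)
      (LinearMap.funLeft_surjective_of_injective _ _ _ (Fin.succ_injective n))) hA ih

lemma ExtDies.of_finite {b : Ideal R} {c : ℕ}
    (hR : ∀ j, c < j → ExtDies b (ModuleCat.of R R) j) (X : ModuleCat.{u} R) [Module.Finite R X]
    (j : ℕ) (hj : c < j) : ExtDies b X j := by
  obtain ⟨d, hd⟩ := exists_forall_extDies b
  suffices H : ∀ (k : ℕ) (X : ModuleCat.{u} R) [Module.Finite R X] (j : ℕ), c < j → d < j + k →
      ExtDies b X j from H (d + 1) X j hj (by omega)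
  intro k
  induction k with
  | zero => exact fun X _ j _ hdj => hd X j hdj
  | succ k ih =>
    intro X _ j hj hdj
    obtain ⟨n, f, hf⟩ := Module.Finite.exists_fin' R X
    have hF : ExtDies b (ModuleCat.of R (Fin n → R)) j :=
      ModuleCat.pi_fin_of_extension (p := fun Y => ExtDies b Y j)
        (fun Y hY => ExtDies.of_subsingleton hY j)
        (fun S hS h₁ h₃ => ExtDies.middle hS h₁ h₃) (hR j hj) n
    exact ExtDies.right (S := f.shortComplexKer) (LinearMap.shortExact_shortComplexKer hf) hF
      (ih (ModuleCat.of R f.ker) (j + 1) (by omega) (by omega))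

lemma ExtDies.of_sSup_lt {b : Ideal R} {c : ℕ}
    (hc : c = sSup {i : ℕ | Nontrivial ((localCohomology b i).obj (ModuleCat.of R R))})
    (X : ModuleCat.{u} R) [Module.Finite R X] (j : ℕ) (hj : c < j) : ExtDies b X j := by
  refine ExtDies.of_finite (fun j hj => ?_) X j hj
  obtain ⟨d, hd⟩ := exists_forall_extDies b
  have hbdd : BddAbove {i : ℕ | Nontrivial ((localCohomology b i).obj (ModuleCat.of R R))} := by
    refine ⟨d, fun i (hi : Nontrivial _) => not_lt.1 fun hdi => ?_⟩
    obtain ⟨i, rfl⟩ : ∃ k, i = k + 1 := ⟨i - 1, by omega⟩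
    exact not_subsingleton_iff_nontrivial.2 hi
      ((subsingleton_localCohomology_iff b i _).2 (hd _ _ hdi))
  obtain ⟨j, rfl⟩ : ∃ k, j = k + 1 := ⟨j - 1, by omega⟩
  rw [← subsingleton_localCohomology_iff, ← not_nontrivial_iff_subsingleton]
  exact fun hn => absurd (le_csSup hbdd hn) (by omega)

end Bound

section TensorComplex
open Limits Opposite Abelian MonoidalCategory

variable {R : Type u} [CommRing R]

/-- The functor `N ↦ N ⊗ K` from modules to chain complexes. -/
noncomputable def ChainComplex.tensorFunctor (K : ChainComplex (ModuleCat.{u} R) ℕ) :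
    ModuleCat.{u} R ⥤ ChainComplex (ModuleCat.{u} R) ℕ where
  obj N := (((tensoringLeft (ModuleCat.{u} R)).obj N).mapHomologicalComplex _).obj K
  map f := (NatTrans.mapHomologicalComplex ((tensoringLeft (ModuleCat.{u} R)).map f) _).app K
  map_id N := by ext; simp
  map_comp f g := by ext; simp

instance (K : ChainComplex (ModuleCat.{u} R) ℕ) : K.tensorFunctor.PreservesZeroMorphisms where
  map_zero X Y := by
    ext i : 1
    exact MonoidalPreadditive.zero_whiskerRight

lemma CategoryTheory.ShortComplex.ShortExact.map_tensorFunctor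
    {K : ChainComplex (ModuleCat.{u} R) ℕ}
    [hK : ∀ i, Projective (K.X i)] {S : ShortComplex (ModuleCat.{u} R)} (hS : S.ShortExact) :
    (S.map K.tensorFunctor).ShortExact := by
  refine HomologicalComplex.shortExact_of_degreewise_shortExact _ fun i => ?_
  have : Module.Projective R (K.X i) := (IsProjective.iff_projective (R := R) (K.X i)).2 (hK i)
  have hinj : Function.Injective S.f := (ModuleCat.mono_iff_injective _).1 hS.mono_f
  have hsurj : Function.Surjective S.g := (ModuleCat.epi_iff_surjective _).1 hS.epi_g
  exact
    { exact := Module.Flat.rTensor_shortComplex_exact (K.X i) S hS.exact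
      mono_f := (ModuleCat.mono_iff_injective _).2
        (Module.Flat.rTensor_preserves_injective_linearMap S.f.hom hinj)
      epi_g := (ModuleCat.epi_iff_surjective _).2
        (LinearMap.rTensor_surjective (K.X i) hsurj) }

lemma ChainComplex.isZero_homology_tensorFunctor_obj {K : ChainComplex (ModuleCat.{u} R) ℕ} {i : ℕ}
    (hK : K.ExactAt (i + 1)) (N : ModuleCat.{u} R) [Module.Flat R N] :
    IsZero ((K.tensorFunctor.obj N).homology (i + 1)) := by
  refine HomologicalComplex.ExactAt.isZero_homology ?_
  rw [HomologicalComplex.exactAt_iff' _ (i + 2) (i + 1) i (by simp) (by simp)] at hK ⊢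
  change ((K.sc' (i + 2) (i + 1) i).map ((tensoringLeft (ModuleCat.{u} R)).obj N)).Exact
  exact Module.Flat.lTensor_shortComplex_exact (R := R) N _ hK

end TensorComplex

section FiniteTor
open Limits Opposite Abelian

variable {R : Type u} [CommRing R]

lemma CategoryTheory.ShortComplex.Exact.moduleFinite_middle [IsNoetherianRing R]
    {T : ShortComplex (ModuleCat.{u} R)} (hT : T.Exact) (h₁ : Module.Finite R T.X₁)
    (h₃ : Module.Finite R T.X₃) : Module.Finite R T.X₂ := by
  rw [ShortComplex.ShortExact.moduleCat_exact_iff_function_exact] at hT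
  refine ⟨Submodule.fg_of_fg_map_of_fg_inf_ker T.g.hom (IsNoetherian.noetherian _) ?_⟩
  rw [top_inf_eq, LinearMap.exact_iff.1 hT]
  exact Module.Finite.iff_fg.1 (Module.Finite.range T.f.hom)

lemma finite_homology_tensor_of_subsingleton {K : ChainComplex (ModuleCat.{u} R) ℕ}
    (X : ModuleCat.{u} R)
    (hX : Subsingleton X) (i : ℕ) : Module.Finite R ((K.tensorFunctor.obj X).homology i) := by
  have h : IsZero ((K.tensorFunctor ⋙ HomologicalComplex.homologyFunctor _ _ i).obj X) :=
    Functor.map_isZero _ (ModuleCat.isZero_of_subsingleton X)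
  have : Subsingleton ((K.tensorFunctor.obj X).homology i) :=
    ModuleCat.subsingleton_of_isZero h
  infer_instance

variable [IsNoetherianRing R] {K : ChainComplex (ModuleCat.{u} R) ℕ} [∀ i, Projective (K.X i)]
  {S : ShortComplex (ModuleCat.{u} R)}

lemma CategoryTheory.ShortComplex.ShortExact.finite_homology_tensor_middle (hS : S.ShortExact)
    {i : ℕ} (h₁ : Module.Finite R ((K.tensorFunctor.obj S.X₁).homology i))
    (h₃ : Module.Finite R ((K.tensorFunctor.obj S.X₃).homology i)) :
    Module.Finite R ((K.tensorFunctor.obj S.X₂).homology i) :=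
  (hS.map_tensorFunctor (K := K).homology_exact₂ i).moduleFinite_middle h₁ h₃

lemma CategoryTheory.ShortComplex.ShortExact.finite_homology_tensor_right (hS : S.ShortExact)
    {i : ℕ} (h₂ : Module.Finite R ((K.tensorFunctor.obj S.X₂).homology i))
    (h₁ : ∀ j, j + 1 = i → Module.Finite R ((K.tensorFunctor.obj S.X₁).homology j)) :
    Module.Finite R ((K.tensorFunctor.obj S.X₃).homology i) := by
  have hS' := hS.map_tensorFunctor (K := K)
  cases i with
  | zero =>
    have : Epi (S.map K.tensorFunctor).g := hS'.epi_g
    have hepi := HomologicalComplex.epi_homologyMap_of_epi_of_not_rel (S.map K.tensorFunctor).g 0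
      (by simp)
    have : Module.Finite R ((S.map K.tensorFunctor).X₂.homology 0) := h₂
    exact Module.Finite.of_surjective _ ((ModuleCat.epi_iff_surjective
      (HomologicalComplex.homologyMap (S.map K.tensorFunctor).g 0)).1 hepi)
  | succ i => exact (hS'.homology_exact₃ (i + 1) i rfl).moduleFinite_middle h₂ (h₁ i rfl)

variable {b : Ideal R} {n : ℕ}

lemma finite_homology_tensor_of_smul_eq_zero
    (hb : ∀ i ≤ n, Module.Finite R ((K.tensorFunctor.obj (ModuleCat.of R (R ⧸ b))).homology i))
    (i : ℕ) (hi : i ≤ n) (N : ModuleCat.{u} R) [Module.Finite R N]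
    (hN : ∀ r ∈ b, ∀ x : N, r • x = 0) :
    Module.Finite R ((K.tensorFunctor.obj N).homology i) := by
  induction i using Nat.strong_induction_on generalizing N with
  | _ i ih =>
    have htors : Module.IsTorsionBySet R N b := fun x a => hN a a.2 x
    let : Module (R ⧸ b) N := htors.module
    have : IsScalarTower R (R ⧸ b) N := htors.isScalarTower
    have : Module.Finite (R ⧸ b) N := Module.Finite.of_restrictScalars_finite R (R ⧸ b) N
    obtain ⟨m, f, hf⟩ := Module.Finite.exists_fin' (R ⧸ b) N
    have hfree : Module.Finite R
        ((K.tensorFunctor.obj (ModuleCat.of R (Fin m → R ⧸ b))).homology i) :=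
      ModuleCat.pi_fin_of_extension
        (p := fun Y => Module.Finite R ((K.tensorFunctor.obj Y).homology i))
        (fun Y hY => finite_homology_tensor_of_subsingleton Y hY i)
        (fun S hS h₁ h₃ => hS.finite_homology_tensor_middle h₁ h₃) (hb i hi) m
    refine (LinearMap.shortExact_shortComplexKer (f := f.restrictScalars R)
      hf).finite_homology_tensor_right hfree fun j hj => ?_
    refine ih j (by omega) (by omega) (ModuleCat.of R (f.restrictScalars R).ker)
      fun r hr x => Subtype.ext (funext fun k => ?_)
    change r • x.1 k = 0
    obtain ⟨y, hy⟩ := Ideal.Quotient.mk_surjective (x.1 k)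
    rw [← hy]
    exact Ideal.Quotient.eq_zero_iff_mem.2 (b.mul_mem_right y hr)

lemma finite_homology_tensor_of_pow_smul_eq_zero
    (hb : ∀ i ≤ n, Module.Finite R ((K.tensorFunctor.obj (ModuleCat.of R (R ⧸ b))).homology i))
    (i : ℕ) (hi : i ≤ n) (k : ℕ) (N : ModuleCat.{u} R) [Module.Finite R N]
    (hN : ∀ r ∈ b ^ k, ∀ x : N, r • x = 0) :
    Module.Finite R ((K.tensorFunctor.obj N).homology i) := by
  induction k generalizing N with
  | zero =>
    exact finite_homology_tensor_of_subsingleton N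
      (subsingleton_of_forall_eq 0 fun x => by simpa using hN 1 (by simp) x) i
  | succ k ih =>
    let N' : Submodule R N := b • ⊤
    refine ((LinearMap.exact_subtype_mkQ N').moduleCat_shortExact
        (Submodule.subtype_injective _)
        (Submodule.mkQ_surjective _)).finite_homology_tensor_middle ?_ ?_
    · refine ih (ModuleCat.of R N') fun r hr x => Subtype.ext ?_
      suffices ∀ y ∈ N', r • y = 0 from this _ x.2
      intro y hy
      refine Submodule.smul_induction_on hy (fun a ha y _ => ?_) fun y z hy hz => ?_
      · rw [← mul_smul]
        exact hN _ (pow_succ b k ▸ Ideal.mul_mem_mul hr ha) y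
      · rw [smul_add, hy, hz, add_zero]
    · refine finite_homology_tensor_of_smul_eq_zero hb i hi (ModuleCat.of R (N ⧸ N'))
        fun r hr x => ?_
      obtain ⟨y, rfl⟩ := Submodule.mkQ_surjective _ x
      exact (Submodule.Quotient.mk_eq_zero N').2 (Submodule.smul_mem_smul hr Submodule.mem_top)

end FiniteTor

section UniversalClass
open Limits Opposite Abelian

variable {R : Type u} [CommRing R] [IsNoetherianRing R] {K : ChainComplex (ModuleCat.{u} R) ℕ}
  [∀ i, Projective (K.X i)]

lemma exists_ext_homologyMap_tensor_eq_zero (hK : ∀ i, K.ExactAt (i + 1)) (j : ℕ)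
    (B : ModuleCat.{u} R) [Module.Finite R B] :
    ∃ (C : ModuleCat.{u} R) (_ : Module.Finite R C) (u : Abelian.Ext B C (j + 1)),
      ∀ (A : ModuleCat.{u} R) (φ : A ⟶ B), (Ext.mk₀ φ).comp u (zero_add _) = 0 →
        ∀ i, j ≤ i → HomologicalComplex.homologyMap (K.tensorFunctor.map φ) (i + 1) = 0 := by
  induction j generalizing B with
  | zero =>
    obtain ⟨n, f, hf⟩ := Module.Finite.exists_fin' R B
    have hS := LinearMap.shortExact_shortComplexKer hf
    refine ⟨ModuleCat.of R f.ker, inferInstance, hS.extClass, fun A φ hφ i _ => ?_⟩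
    obtain ⟨x, hx⟩ := Ext.covariant_sequence_exact₃ A hS (Ext.mk₀ φ) (zero_add 1) hφ
    obtain ⟨ψ, rfl⟩ := (Ext.mk₀_bijective _ _).2 x
    rw [Ext.mk₀_comp_mk₀] at hx
    obtain rfl := (Ext.mk₀_bijective _ _).1 hx
    rw [Functor.map_comp, HomologicalComplex.homologyMap_comp]
    exact ((ChainComplex.isZero_homology_tensorFunctor_obj (hK i)
      (ModuleCat.of R (Fin n → R))).eq_zero_of_tgt _ =≫ _).trans zero_comp
  | succ j ih =>
    obtain ⟨n, f, hf⟩ := Module.Finite.exists_fin' R B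
    have hS := LinearMap.shortExact_shortComplexKer hf
    obtain ⟨C, hC, u, hu⟩ := ih (ModuleCat.of R f.ker)
    refine ⟨C, hC, hS.extClass.comp u (add_comm _ _), fun A φ hφ i hi => ?_⟩
    obtain ⟨i, rfl⟩ : ∃ k, i = k + 1 := ⟨i - 1, by omega⟩
    have hSA := A.shortExact_projectiveShortComplex
    have := hS.epi_g
    have := hS.mono_f
    let g : A.projectiveShortComplex.X₂ ⟶ f.shortComplexKer.X₂ :=
      Projective.factorThru (A.projectiveShortComplex.g ≫ φ) f.shortComplexKer.g
    have hg : g ≫ f.shortComplexKer.g = A.projectiveShortComplex.g ≫ φ :=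
      Projective.factorThru_comp _ _
    have hz : (A.projectiveShortComplex.f ≫ g) ≫ f.shortComplexKer.g = 0 := by
      rw [Category.assoc, hg, ShortComplex.zero_assoc, zero_comp]
    let m : A.projectiveShortComplex ⟶ f.shortComplexKer :=
      { τ₁ := hS.exact.lift _ hz
        τ₂ := g
        τ₃ := φ
        comm₁₂ := hS.exact.lift_f _ hz
        comm₂₃ := hg }
    have hm : (Ext.mk₀ m.τ₁).comp u (zero_add _) = 0 := by
      obtain ⟨x, hx⟩ := Ext.contravariant_sequence_exact₁ hSA C
        ((Ext.mk₀ m.τ₁).comp u (zero_add _)) (add_comm 1 (j + 1)) (by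
          rw [← Ext.comp_assoc_of_second_deg_zero,
            ShortComplex.ShortExact.extClass_naturality hSA hS m,
            Ext.comp_assoc _ _ _ (zero_add 1) (add_comm 1 (j + 1)) (by omega)]
          exact hφ)
      rw [← hx, Ext.eq_zero_of_projective x, Ext.comp_zero]
    have h1 := hu _ _ hm i (by omega)
    have h2 := HomologicalComplex.HomologySequence.δ_naturality
      (K.tensorFunctor.mapShortComplex.map m) (hSA.map_tensorFunctor (K := K))
      (hS.map_tensorFunctor (K := K)) (i + 2) (i + 1) rfl
    have h3 : Mono ((hS.map_tensorFunctor (K := K)).δ (i + 2) (i + 1) rfl) :=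
      (hS.map_tensorFunctor (K := K)).mono_δ (i + 2) (i + 1) rfl
        (ChainComplex.isZero_homology_tensorFunctor_obj (hK (i + 1)) _)
    refine (cancel_mono ((hS.map_tensorFunctor (K := K)).δ (i + 2) (i + 1) rfl)).1 ?_
    exact h2.symm.trans ((congrArg (_ ≫ ·) h1).trans (comp_zero.trans zero_comp.symm))

variable {b : Ideal R} {c : ℕ}

lemma finite_homology_tensor_succ (hK : ∀ i, K.ExactAt (i + 1))
    (hc : c = sSup {i : ℕ | Nontrivial ((localCohomology b i).obj (ModuleCat.of R R))}) {n : ℕ}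
    (hn : c ≤ n)
    (hb : ∀ i ≤ n, Module.Finite R ((K.tensorFunctor.obj (ModuleCat.of R (R ⧸ b))).homology i)) :
    Module.Finite R ((K.tensorFunctor.obj (ModuleCat.of R (R ⧸ b))).homology (n + 1)) := by
  suffices Module.Finite R
      ((K.tensorFunctor.obj (ModuleCat.of R (R ⧸ b ^ 1))).homology (n + 1)) by
    rwa [pow_one] at this
  obtain ⟨C, _, u, hu⟩ := exists_ext_homologyMap_tensor_eq_zero hK n (ModuleCat.of R (R ⧸ b ^ 1))
  obtain ⟨t, ht, h⟩ := ExtDies.of_sSup_lt hc C (n + 1) (by omega) 1 u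
  have h0 := hu _ _ h n le_rfl
  have hsurj : Function.Surjective (quotientPowMap b ht).hom :=
    fun x => by
      obtain ⟨y, rfl⟩ := Ideal.Quotient.mk_surjective x
      exact ⟨Ideal.Quotient.mk _ y, rfl⟩
  have hS := LinearMap.shortExact_shortComplexKer hsurj
  have hS' := hS.map_tensorFunctor (K := K)
  have hmono := (hS'.homology_exact₃ (n + 1) n rfl).mono_g h0
  have hfin : Module.Finite R
      (((quotientPowMap b ht).hom.shortComplexKer.map K.tensorFunctor).X₁.homology n) :=
    finite_homology_tensor_of_pow_smul_eq_zero hb n le_rfl t _ fun r hr x => Subtype.ext (by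
      obtain ⟨y, hy⟩ := Ideal.Quotient.mk_surjective x.1
      change r • x.1 = 0
      rw [← hy]
      exact Ideal.Quotient.eq_zero_iff_mem.2 ((b ^ t).mul_mem_right y hr))
  exact Module.Finite.of_injective _ ((ModuleCat.mono_iff_injective
    (hS'.δ (n + 1) n rfl)).1 hmono)

lemma finite_homology_tensor_of_le_cd (hK : ∀ i, K.ExactAt (i + 1))
    (hc : c = sSup {i : ℕ | Nontrivial ((localCohomology b i).obj (ModuleCat.of R R))})
    (hb : ∀ i ≤ c, Module.Finite R ((K.tensorFunctor.obj (ModuleCat.of R (R ⧸ b))).homology i))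
    (i : ℕ) : Module.Finite R ((K.tensorFunctor.obj (ModuleCat.of R (R ⧸ b))).homology i) := by
  induction i using Nat.strong_induction_on with
  | _ i ih =>
    by_cases hi : i ≤ c
    · exact hb i hi
    · obtain ⟨n, rfl⟩ : ∃ n, i = n + 1 := ⟨i - 1, by omega⟩
      exact finite_homology_tensor_succ hK hc (by omega) fun k hk => ih k (by omega)

end UniversalClass

/-- Let `N` be a finitely generated `R`-module with annihilator `b = Ann_R(N)` and let
`c = cd(b, R)`. If `Tor_i(R/b, M)` is finitely generated for every `0 ≤ i ≤ c`, then
`Tor_i(N, M)` is finitely generated for every `i ≥ 0`. -/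
theorem tor_finite_of_tor_quotient_annihilator_finite_up_to_cd
    {R : Type u} [CommRing R] [IsNoetherianRing R]
    (N : Type u) [AddCommGroup N] [Module R N] [Module.Finite R N]
    (M : Type u) [AddCommGroup M] [Module R M]
    (b : Ideal R) (hb : b = Module.annihilator R N)
    (c : ℕ)
    (hc : c = sSup {i : ℕ | Nontrivial ((localCohomology b i).obj (ModuleCat.of R R))})
    (h : ∀ i : ℕ, i ≤ c → Module.Finite R
      (((Tor (ModuleCat.{u} R) i).obj (ModuleCat.of R (R ⧸ b))).obj (ModuleCat.of R M)))
    (i : ℕ) :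
    Module.Finite R
      (((Tor (ModuleCat.{u} R) i).obj (ModuleCat.of R N)).obj (ModuleCat.of R M)) := by
  let P := projectiveResolution (ModuleCat.of R M)
  have hP : ∀ i, Projective (P.complex.X i) := P.projective
  have e (X : ModuleCat.{u} R) (j : ℕ) :
      ((Tor (ModuleCat.{u} R) j).obj X).obj (ModuleCat.of R M) ≃ₗ[R]
        (P.complex.tensorFunctor.obj X).homology j :=
    (P.isoLeftDerivedObj ((MonoidalCategory.tensoringLeft (ModuleCat.{u} R)).obj X)
      j).toLinearEquiv
  have hfin := finite_homology_tensor_of_le_cd P.complex_exactAt_succ hc fun j hj =>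
    have := h j hj
    Module.Finite.equiv (e _ j)
  have := finite_homology_tensor_of_smul_eq_zero (n := i) (fun j _ => hfin j) i le_rfl
    (ModuleCat.of R N) fun r hr x => Module.mem_annihilator.1 (hb ▸ hr) x
  exact Module.Finite.equiv (e _ i).symm
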